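/- There is no irreducible signature f : {0,1}^4 → ℂ of arity 4 that satisfies ARS and second order orthogonality and is such that for every pair of distinct indices {i, j} the binary merge ∂_{ij} f = f^{01}_{ij} + f^{10}_{ij} has parity (its support lies entirely in the even-weight inputs or entirely in the odd-weight inputs; the zero binary signature counts as having parity). -/

import Mathlib

namespace Stmt15

/-- The Hamming weight of an assignment. -/
def hw {ι : Type*} [Fintype ι] (x : ι → Bool) : ℕ :=
  (Finset.univ.filter fun i => x i = true).card

/-- The signature obtained from `f` by pinning `x_i := a`, `x_j := b`. -/
def pin2 {n : ℕ} (f : (Fin n → Bool) → ℂ) (i j : Fin n) (a b : Bool)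
    (y : {k : Fin n // k ≠ i ∧ k ≠ j} → Bool) : ℂ :=
  f fun k => if h : k = i then a else if h' : k = j then b else y ⟨k, h, h'⟩

/-- The merge `∂_{ij} f = f^{01}_{ij} + f^{10}_{ij}` of `f` at `i, j` via the binary
disequality. -/
def merge {n : ℕ} (f : (Fin n → Bool) → ℂ) (i j : Fin n)
    (y : {k : Fin n // k ≠ i ∧ k ≠ j} → Bool) : ℂ :=
  pin2 f i j false true y + pin2 f i j true false y

/-- Arrow reversal symmetry: `conj (f α) = f ᾱ`. -/
def ARS {n : ℕ} (f : (Fin n → Bool) → ℂ) : Prop :=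
  ∀ x : Fin n → Bool, (starRingEnd ℂ) (f x) = f fun i => !(x i)

/-- Second order orthogonality with constant `lam`. -/
def SecondOrth {n : ℕ} (f : (Fin n → Bool) → ℂ) (lam : ℝ) : Prop :=
  lam ≠ 0 ∧
    ∀ i j : Fin n, i ≠ j →
      (∀ a b : Bool, (∑ y, Complex.normSq (pin2 f i j a b y)) = lam) ∧
      (∀ a b c d : Bool, (a, b) ≠ (c, d) →
        (∑ y, pin2 f i j a b y * (starRingEnd ℂ) (pin2 f i j c d y)) = 0)

/-- A signature is reducible if it is a (pointwise) product of a signature on a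
nonempty proper subset `S` of its variables and a signature on the complement. -/
def Reducible {n : ℕ} (f : (Fin n → Bool) → ℂ) : Prop :=
  ∃ S : Finset (Fin n), S.Nonempty ∧ S ≠ Finset.univ ∧
    ∃ (g : ({k : Fin n // k ∈ S} → Bool) → ℂ)
      (h : ({k : Fin n // k ∉ S} → Bool) → ℂ),
      ∀ x : Fin n → Bool, f x = g (fun k => x k.1) * h (fun k => x k.1)

/-- A signature has parity: its support lies entirely in the even-weight inputs or
entirely in the odd-weight inputs (the zero signature counts). -/
def HasParity {ι : Type*} [Fintype ι] (g : (ι → Bool) → ℂ) : Prop :=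
  (∀ y, Odd (hw y) → g y = 0) ∨ (∀ y, Even (hw y) → g y = 0)

def hiBit : Fin 4 → Bool := ![false, false, true, true]
def loBit : Fin 4 → Bool := ![false, true, false, true]

/-- The matrix of a function of four bits, with rows indexed by the first two. -/
def mat (F : Bool → Bool → Bool → Bool → ℂ) : Matrix (Fin 4) (Fin 4) ℂ :=
  Matrix.of fun r c => F (hiBit r) (loBit r) (hiBit c) (loBit c)

/-- `det` is real (by arrow reversal) and has modulus `lam ^ 2`. -/
lemma det_mat (F : Bool → Bool → Bool → Bool → ℂ) (lam : ℝ)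
    (hF : ∀ a b c d, (starRingEnd ℂ) (F a b c d) = F (!a) (!b) (!c) (!d))
    (h1 : ∀ a b, ∑ p : Bool × Bool, Complex.normSq (F a b p.1 p.2) = lam)
    (h2 : ∀ a b c d, (a, b) ≠ (c, d) →
      ∑ p : Bool × Bool, F a b p.1 p.2 * (starRingEnd ℂ) (F c d p.1 p.2) = 0) :
    (mat F).det = (lam : ℂ) ^ 2 ∨ (mat F).det = -(lam : ℂ) ^ 2 := by
  have hmul : mat F * (mat F).conjTranspose = (lam : ℂ) • (1 : Matrix (Fin 4) (Fin 4) ℂ) := by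
    ext r c
    have key : (mat F * (mat F).conjTranspose) r c =
        ∑ p : Bool × Bool, F (hiBit r) (loBit r) p.1 p.2 *
          (starRingEnd ℂ) (F (hiBit c) (loBit c) p.1 p.2) := by
      simp [Matrix.mul_apply, mat, Fin.sum_univ_four, Fintype.sum_prod_type, hiBit, loBit]
      ring
    rw [key]
    by_cases hrc : r = c
    · subst hrc
      simp only [Complex.mul_conj]
      rw [← Complex.ofReal_sum, h1]
      simp
    · rw [h2]
      · simp [hrc]
      · clear key
        revert r c
        decide
  have hconj : (starRingEnd ℂ) (mat F).det = (mat F).det := by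
    rw [RingHom.map_det]
    have : (starRingEnd ℂ).mapMatrix (mat F) = (mat F).submatrix Fin.revPerm Fin.revPerm := by
      ext r c
      simp only [RingHom.mapMatrix_apply, Matrix.map_apply, mat, Matrix.of_apply,
        Matrix.submatrix_apply, hF]
      have e1 : ∀ r : Fin 4, (!hiBit r) = hiBit (Fin.revPerm r) := by decide
      have e2 : ∀ r : Fin 4, (!loBit r) = loBit (Fin.revPerm r) := by decide
      simp only [e1, e2]
    rw [this, Matrix.det_submatrix_equiv_self]
  have hd := congrArg Matrix.det hmul
  rw [Matrix.det_mul, Matrix.det_conjTranspose, Matrix.det_smul] at hd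
  have hs : star (mat F).det = (mat F).det := hconj
  rw [hs] at hd
  simp only [Fintype.card_fin, Matrix.det_one, mul_one] at hd
  apply sq_eq_sq_iff_eq_or_eq_neg.mp
  rw [pow_two, hd]
  ring

/-- The three determinants of a four-bit function are linearly dependent. -/
lemma det_identity (F : Bool → Bool → Bool → Bool → ℂ) :
    (mat F).det - (mat fun a b c d => F a c b d).det + (mat fun a b c d => F a c d b).det = 0 := by
  simp [mat, Matrix.det_succ_row_zero, Fin.sum_univ_succ, hiBit, loBit, Fin.succAbove]
  ring

lemma sum_sub {M : Type*} [AddCommMonoid M] (i j k l : Fin 4)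
    (hk : k ≠ i ∧ k ≠ j) (hl : l ≠ i ∧ l ≠ j) (hkl : k ≠ l) (hij : i ≠ j)
    (G : ({m : Fin 4 // m ≠ i ∧ m ≠ j} → Bool) → M) :
    ∑ y, G y = ∑ p : Bool × Bool, G (fun m => if m.1 = k then p.1 else p.2) := by
  symm
  apply Fintype.sum_bijective (fun (p : Bool × Bool) (m : {m : Fin 4 // m ≠ i ∧ m ≠ j}) =>
    if m.1 = k then p.1 else p.2)
  · constructor
    · intro p q h
      have a := congrFun h ⟨k, hk⟩
      have b := congrFun h ⟨l, hl⟩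
      simp [hkl.symm] at a b
      exact Prod.ext a b
    · intro y
      refine ⟨(y ⟨k, hk⟩, y ⟨l, hl⟩), ?_⟩
      funext ⟨m, hm⟩
      by_cases h : m = k
      · subst h; simp
      · have : m = l := by
          clear G y
          revert i j k l m
          decide
        subst this
        simp [h]
  · intro p; rfl

/-- Determinant lemma applied to the split `{0, j} | {k, l}`. -/
lemma det_split (f : (Fin 4 → Bool) → ℂ) (hA : ARS f) (lam : ℝ) (hS : SecondOrth f lam)
    (i j k l : Fin 4) (hk : k ≠ i ∧ k ≠ j) (hl : l ≠ i ∧ l ≠ j) (hkl : k ≠ l) (hij : i ≠ j)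
    (F : Bool → Bool → Bool → Bool → ℂ)
    (hF : ∀ a b c d, F a b c d =
      f (fun m => if m = i then a else if m = j then b else if m = k then c else d)) :
    (mat F).det = (lam : ℂ) ^ 2 ∨ (mat F).det = -(lam : ℂ) ^ 2 := by
  obtain ⟨-, h⟩ := hS
  obtain ⟨h1, h2⟩ := h i j hij
  have hp : ∀ a b (p : Bool × Bool),
      pin2 f i j a b (fun m => if m.1 = k then p.1 else p.2) = F a b p.1 p.2 := by
    intro a b p
    rw [hF]
    simp only [pin2]
    congr 1
  apply det_mat
  · intro a b c d
    rw [hF, hF, hA]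
    congr 1
    funext m
    split_ifs <;> rfl
  · intro a b
    have := h1 a b
    rw [sum_sub i j k l hk hl hkl hij] at this
    simpa only [hp] using this
  · intro a b c d hne
    have := h2 a b c d hne
    rw [sum_sub i j k l hk hl hkl hij] at this
    simpa only [hp] using this

/-- There is no irreducible arity-4 signature satisfying ARS and second order
orthogonality all of whose binary merges `∂_{ij} f` have parity. -/
theorem no_irreducible_arity_four :
    ¬ ∃ f : (Fin 4 → Bool) → ℂ,
        ¬ Reducible f ∧ ARS f ∧ (∃ lam : ℝ, SecondOrth f lam) ∧
          ∀ i j : Fin 4, i ≠ j → HasParity (merge f i j) := by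
  rintro ⟨f, -, hA, ⟨lam, hS⟩, -⟩
  have hl : (lam : ℂ) ^ 2 ≠ 0 := pow_ne_zero _ (by exact_mod_cast hS.1)
  let F : Bool → Bool → Bool → Bool → ℂ := fun a b c d => f ![a, b, c, d]
  have D1 := det_split f hA lam hS 0 1 2 3 (by decide) (by decide) (by decide) (by decide) F
    (by intro a b c d; apply congrArg f; funext m; fin_cases m <;> rfl)
  have D2 := det_split f hA lam hS 0 2 1 3 (by decide) (by decide) (by decide) (by decide)
    (fun a b c d => F a c b d)
    (by intro a b c d; apply congrArg f; funext m; fin_cases m <;> rfl)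
  have D3 := det_split f hA lam hS 0 3 1 2 (by decide) (by decide) (by decide) (by decide)
    (fun a b c d => F a c d b)
    (by intro a b c d; apply congrArg f; funext m; fin_cases m <;> rfl)
  have I := det_identity F
  rcases D1 with D1 | D1 <;> rcases D2 with D2 | D2 <;> rcases D3 with D3 | D3 <;>
    rw [D1, D2, D3] at I <;> apply hl
  all_goals first
    | linear_combination I
    | linear_combination -I
    | linear_combination (1 / 3 : ℂ) * I
    | linear_combination (-1 / 3 : ℂ) * I

end Stmt15
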